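/- Let L and S be independent non-negative random variables with L \in RV_{-\beta}, S \in RV_{-\gamma}, \beta + 1 < \gamma. Assume F_L has a positive, non-increasing density f_L on [x_0, \infty) for some x_0 > 0. Then VaR_\alpha(L+S) - VaR_\alpha(L) \to E[S] as \alpha \to 1. -/

import Mathlib

open MeasureTheory ProbabilityTheory Filter Topology

/-- Tail probability function of a random variable. -/
noncomputable def tail {Ω : Type*} [MeasurableSpace Ω] (P : Measure Ω) (X : Ω → ℝ) (x : ℝ) : ℝ :=
  (P {ω | x < X ω}).toReal

/-- Distribution function of a random variable. -/
noncomputable def cdf' {Ω : Type*} [MeasurableSpace Ω] (P : Measure Ω) (X : Ω → ℝ) (x : ℝ) : ℝ :=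
  (P {ω | X ω ≤ x}).toReal

/-- Value at Risk: the α-quantile. -/
noncomputable def VaR {Ω : Type*} [MeasurableSpace Ω] (P : Measure Ω) (X : Ω → ℝ) (α : ℝ) : ℝ :=
  sInf {x : ℝ | α ≤ cdf' P X x}

/-- f is regularly varying (at infinity) with index k. -/
def RegVary (f : ℝ → ℝ) (k : ℝ) : Prop :=
  ∀ t : ℝ, 0 < t → Tendsto (fun x => f (t * x) / f x) atTop (𝓝 (t ^ k))

/-- The two-sided bound on the increments of `F` given by a non-increasing density `f` of `-F`
on `[x₀, ∞)`. -/
def DensityBounds (F f : ℝ → ℝ) (x₀ : ℝ) : Prop :=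
  ∀ x y, x₀ ≤ x → x₀ ≤ y → (y - x) * f y ≤ F x - F y ∧ F x - F y ≤ (y - x) * f x

lemma tendsto_zero_of_doubling {h : ℝ → ℝ} {r X B : ℝ} (hr0 : 0 ≤ r) (hr1 : r < 1) (hX : 0 < X)
    (hpos : ∀ x, X ≤ x → 0 ≤ h x) (hdouble : ∀ x, X ≤ x → h (2 * x) ≤ r * h x)
    (hB : ∀ x, X ≤ x → x ≤ 2 * X → h x ≤ B) : Tendsto h atTop (𝓝 0) := by
  have hB0 : 0 ≤ B := (hpos X le_rfl).trans (hB X le_rfl (by linarith))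
  have key : ∀ n : ℕ, ∀ x, 2 ^ n * X ≤ x → x ≤ 2 ^ (n + 1) * X → h x ≤ r ^ n * B := by
    intro n
    induction n with
    | zero => intro x h1 h2; simpa using hB x (by simpa using h1) (by simpa using h2)
    | succ n ih =>
      intro x h1 h2
      have hx1 : 2 ^ n * X ≤ x / 2 := by rw [pow_succ] at h1; linarith
      have hx2 : x / 2 ≤ 2 ^ (n + 1) * X := by rw [pow_succ] at h2; linarith
      have hXx : X ≤ x / 2 :=
        (le_mul_of_one_le_left hX.le (one_le_pow₀ (by norm_num))).trans hx1
      have h3 := hdouble (x / 2) hXx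
      rw [mul_div_cancel₀ x two_ne_zero] at h3
      calc h x ≤ r * h (x / 2) := h3
        _ ≤ r * (r ^ n * B) := mul_le_mul_of_nonneg_left (ih _ hx1 hx2) hr0
        _ = r ^ (n + 1) * B := by ring
  have hlim : Tendsto (fun n : ℕ => r ^ n * B) atTop (𝓝 0) := by
    simpa using (tendsto_pow_atTop_nhds_zero_of_lt_one hr0 hr1).mul_const B
  rw [tendsto_order]
  refine ⟨fun a ha => ?_, fun ε hε => ?_⟩
  · filter_upwards [eventually_ge_atTop X] with x hx using ha.trans_le (hpos x hx)
  · obtain ⟨N, hN⟩ := ((tendsto_order.1 hlim).2 ε hε).exists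
    filter_upwards [eventually_ge_atTop (2 ^ N * X)] with x hx
    have hXx : X ≤ x := (le_mul_of_one_le_left hX.le (one_le_pow₀ (by norm_num))).trans hx
    obtain ⟨n, hn1, hn2⟩ := exists_nat_pow_near (x := x / X) (y := (2 : ℝ))
      ((one_le_div hX).2 hXx) (by norm_num)
    rw [le_div_iff₀ hX] at hn1
    rw [div_lt_iff₀ hX] at hn2
    have hlt : (2 : ℝ) ^ N < 2 ^ (n + 1) := lt_of_mul_lt_mul_right (hx.trans_lt hn2) hX.le
    have hNn : N ≤ n := Nat.lt_succ_iff.1 ((pow_lt_pow_iff_right₀ (by norm_num)).1 hlt)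
    calc h x ≤ r ^ n * B := key n x hn1 hn2.le
      _ ≤ r ^ N * B := mul_le_mul_of_nonneg_right (pow_le_pow_of_le_one hr0 hr1.le hNn) hB0
      _ < ε := hN

lemma tendsto_slope_rpow_neg (β : ℝ) :
    Tendsto (fun t : ℝ => (1 - t ^ (-β)) / (t - 1)) (𝓝[≠] 1) (𝓝 β) := by
  have h := (Real.hasDerivAt_rpow_const (x := 1) (p := -β) (Or.inl one_ne_zero))
  rw [hasDerivAt_iff_tendsto_slope] at h
  have h2 := h.neg
  simp only [Real.one_rpow, mul_one, neg_neg] at h2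
  refine h2.congr fun t => ?_
  simp only [slope_def_field, Real.one_rpow]
  ring

lemma DensityBounds.tendsto_mul_div {F f : ℝ → ℝ} {x₀ β : ℝ} (hd : DensityBounds F f x₀)
    (hF : ∀ x, x₀ ≤ x → 0 < F x) (hRV : RegVary F (-β)) :
    Tendsto (fun x => x * f x / F x) atTop (𝓝 β) := by
  have hquot : ∀ t : ℝ, 0 < t → Tendsto (fun x => (1 - F (t * x) / F x) / (t - 1)) atTop
      (𝓝 ((1 - t ^ (-β)) / (t - 1))) := fun t ht => ((hRV t ht).const_sub 1).div_const _
  have hscale : ∀ t : ℝ, 0 < t → ∀ᶠ x in atTop, x₀ ≤ t * x := fun t ht =>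
    (tendsto_id.const_mul_atTop ht).eventually_ge_atTop x₀
  rw [tendsto_order]
  refine ⟨fun a ha => ?_, fun a ha => ?_⟩
  · have h1 := ((tendsto_slope_rpow_neg β).mono_left
      (nhdsWithin_mono 1 (s := Set.Ioi 1) fun t ht => ne_of_gt ht)).eventually (lt_mem_nhds ha)
    obtain ⟨t, hta, ht1⟩ := (h1.and self_mem_nhdsWithin).exists
    have ht1 : 1 < t := ht1
    have ht0 : 0 < t := by linarith
    filter_upwards [(hquot t ht0).eventually (lt_mem_nhds hta), eventually_ge_atTop x₀,
      hscale t ht0] with x h2 h3 h4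
    refine h2.trans_le ?_
    have hFx := hF x h3
    have h5 := (hd x (t * x) h3 h4).2
    rw [div_le_iff₀ (by linarith), one_sub_div hFx.ne', div_mul_eq_mul_div]
    exact div_le_div_of_nonneg_right (h5.trans (le_of_eq (by ring))) hFx.le
  · have h1 := ((tendsto_slope_rpow_neg β).mono_left
      (nhdsWithin_mono 1 (s := Set.Iio 1) fun t ht => ne_of_lt ht)).eventually (gt_mem_nhds ha)
    have h0 : ∀ᶠ t : ℝ in 𝓝[<] 1, 0 < t := nhdsWithin_le_nhds (lt_mem_nhds one_pos)
    obtain ⟨t, ⟨hta, ht0⟩, ht1⟩ := ((h1.and h0).and self_mem_nhdsWithin).exists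
    have ht1 : t < 1 := ht1
    filter_upwards [(hquot t ht0).eventually (gt_mem_nhds hta), eventually_ge_atTop x₀,
      hscale t ht0] with x h2 h3 h4
    refine lt_of_le_of_lt ?_ h2
    have hFx := hF x h3
    have h5 := (hd x (t * x) h3 h4).2
    rw [le_div_iff_of_neg (by linarith), one_sub_div hFx.ne', div_mul_eq_mul_div]
    exact div_le_div_of_nonneg_right (h5.trans (le_of_eq (by ring))) hFx.le

lemma DensityBounds.regVary {F f : ℝ → ℝ} {x₀ β : ℝ} (hd : DensityBounds F f x₀)
    (hF : ∀ x, x₀ ≤ x → 0 < F x) (hf : ∀ x, x₀ ≤ x → 0 < f x) (hβ : 0 < β)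
    (hRV : RegVary F (-β)) : RegVary f (-β - 1) := by
  intro t ht
  have h1 := hd.tendsto_mul_div hF hRV
  have htx : Tendsto (fun x : ℝ => t * x) atTop atTop := tendsto_id.const_mul_atTop ht
  have h2 := (((h1.comp htx).div h1 hβ.ne').mul (hRV t ht)).div_const t
  rw [div_self hβ.ne', one_mul, ← Real.rpow_sub_one ht.ne'] at h2
  refine h2.congr' ?_
  filter_upwards [eventually_ge_atTop x₀, htx.eventually_ge_atTop x₀, eventually_gt_atTop 0]
    with x hx1 hx2 hx0
  have a1 := (hF x hx1).ne'
  have a2 := (hF _ hx2).ne'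
  have a3 := (hf x hx1).ne'
  have a4 := hx0.ne'
  have a5 := ht.ne'
  simp only [Pi.div_apply, Function.comp_apply]
  field_simp

lemma RegVary.tendsto_add_div {f : ℝ → ℝ} {x₀ k : ℝ} (hRV : RegVary f k)
    (hf : ∀ x, x₀ ≤ x → 0 < f x) (hmono : ∀ x y, x₀ ≤ x → x ≤ y → f y ≤ f x) (d : ℝ) :
    Tendsto (fun x => f (x + d) / f x) atTop (𝓝 1) := by
  have hcont : Tendsto (fun t : ℝ => t ^ k) (𝓝 1) (𝓝 1) := by
    simpa using (Real.continuousAt_rpow_const 1 k (Or.inl one_ne_zero)).tendsto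
  have hxd : Tendsto (fun x : ℝ => x + d) atTop atTop := tendsto_atTop_add_const_right _ _ tendsto_id
  rw [tendsto_order]
  refine ⟨fun a ha => ?_, fun a ha => ?_⟩
  · have h1 := (hcont.mono_left (nhdsWithin_le_nhds (s := Set.Ioi 1))).eventually (lt_mem_nhds ha)
    obtain ⟨t, hta, ht1⟩ := (h1.and self_mem_nhdsWithin).exists
    have ht1 : 1 < t := ht1
    have hlin : Tendsto (fun x : ℝ => (t - 1) * x) atTop atTop :=
      tendsto_id.const_mul_atTop (by linarith)
    filter_upwards [(hRV t (by linarith)).eventually (lt_mem_nhds hta), eventually_ge_atTop x₀,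
      hxd.eventually_ge_atTop x₀, hlin.eventually_ge_atTop d] with x h2 h3 h4 h5
    exact h2.trans_le (div_le_div_of_nonneg_right (hmono _ _ h4 (by linarith)) (hf x h3).le)
  · have h1 := (hcont.mono_left (nhdsWithin_le_nhds (s := Set.Iio 1))).eventually (gt_mem_nhds ha)
    have h0 : ∀ᶠ t : ℝ in 𝓝[<] 1, 0 < t := nhdsWithin_le_nhds (lt_mem_nhds one_pos)
    obtain ⟨t, ⟨hta, ht0⟩, ht1⟩ :=
      ((h1.and h0).and self_mem_nhdsWithin).exists
    have ht1 : t < 1 := ht1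
    have hlin : Tendsto (fun x : ℝ => (1 - t) * x) atTop atTop :=
      tendsto_id.const_mul_atTop (by linarith)
    have htx : Tendsto (fun x : ℝ => t * x) atTop atTop := tendsto_id.const_mul_atTop ht0
    filter_upwards [(hRV t ht0).eventually (gt_mem_nhds hta), eventually_ge_atTop x₀,
      htx.eventually_ge_atTop x₀, hlin.eventually_ge_atTop (-d)] with x h2 h3 h4 h5
    exact (div_le_div_of_nonneg_right (hmono _ _ h4 (by linarith)) (hf x h3).le).trans_lt h2

lemma DensityBounds.tendsto_sub_div {F f : ℝ → ℝ} {x₀ : ℝ} (hd : DensityBounds F f x₀)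
    (hf : ∀ x, x₀ ≤ x → 0 < f x)
    (hshift : ∀ d, Tendsto (fun x => f (x + d) / f x) atTop (𝓝 1)) (c : ℝ) :
    Tendsto (fun x => (F (x - c) - F x) / f x) atTop (𝓝 c) := by
  have hxd : Tendsto (fun x : ℝ => x + -c) atTop atTop :=
    tendsto_atTop_add_const_right _ _ tendsto_id
  have h1 : Tendsto (fun x => c * (f (x + -c) / f x)) atTop (𝓝 c) := by
    simpa using (hshift (-c)).const_mul c
  refine tendsto_of_tendsto_of_tendsto_of_le_of_le' tendsto_const_nhds h1 ?_ ?_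
  · filter_upwards [eventually_ge_atTop x₀, hxd.eventually_ge_atTop x₀] with x h2 h3
    have h4 := (hd (x + -c) x h3 h2).1
    rw [le_div_iff₀ (hf x h2)]
    simpa [sub_eq_add_neg] using h4
  · filter_upwards [eventually_ge_atTop x₀, hxd.eventually_ge_atTop x₀] with x h2 h3
    have h4 := (hd (x + -c) x h3 h2).2
    rw [mul_div_assoc']
    refine div_le_div_of_nonneg_right ?_ (hf x h2).le
    simpa [sub_eq_add_neg] using h4

lemma RegVary.tendsto_div_zero {G f : ℝ → ℝ} {x₀ a b : ℝ} (hG : RegVary G a) (hf : RegVary f b)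
    (hab : a < b) (hG0 : ∀ x, 0 ≤ G x) (hGanti : Antitone G) (hfpos : ∀ x, x₀ ≤ x → 0 < f x)
    (hmono : ∀ x y, x₀ ≤ x → x ≤ y → f y ≤ f x) :
    Tendsto (fun x => G x / f x) atTop (𝓝 0) := by
  have hlim := (hG 2 two_pos).div (hf 2 two_pos) (Real.rpow_pos_of_pos two_pos b).ne'
  rw [← Real.rpow_sub two_pos] at hlim
  obtain ⟨r, hr, hr1⟩ := exists_between
    (Real.rpow_lt_one_of_one_lt_of_neg (one_lt_two (α := ℝ)) (sub_neg.2 hab))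
  have hr0 : 0 ≤ r := (Real.rpow_pos_of_pos two_pos _).le.trans hr.le
  obtain ⟨X₁, hX₁⟩ := eventually_atTop.1 (hlim.eventually (gt_mem_nhds hr))
  set X := max (max X₁ x₀) 1
  have hX0 : 0 < X := one_pos.trans_le (le_max_right _ _)
  have hXX₁ : X₁ ≤ X := (le_max_left _ _).trans (le_max_left _ _)
  have hXx₀ : x₀ ≤ X := (le_max_right _ _).trans (le_max_left _ _)
  refine tendsto_zero_of_doubling (B := G X / f (2 * X)) hr0 hr1 hX0
    (fun x hx => div_nonneg (hG0 x) (hfpos x (hXx₀.trans hx)).le) (fun x hx => ?_)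
    (fun x hx hx2 => ?_)
  · have hfx := hfpos x (hXx₀.trans hx)
    have hf2x := hfpos (2 * x) (by linarith)
    rcases (hG0 x).eq_or_lt with h0 | h0
    · have : G (2 * x) = 0 := le_antisymm (h0 ▸ hGanti (by linarith)) (hG0 _)
      simp [this, ← h0]
    · have h1 := (hX₁ x (hXX₁.trans hx)).le
      simp only [Pi.div_apply] at h1
      rw [div_div_div_eq, div_le_iff₀ (mul_pos h0 hf2x)] at h1
      rw [mul_div_assoc', div_le_div_iff₀ hf2x hfx]
      linarith
  · have hfx := hfpos (2 * X) (by linarith)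
    exact div_le_div₀ (hG0 X) (hGanti hx) hfx (hmono _ _ (hXx₀.trans hx) hx2)

lemma tail_nonneg {Ω : Type*} [MeasurableSpace Ω] {P : Measure Ω} {X : Ω → ℝ} (x : ℝ) :
    0 ≤ tail P X x := ENNReal.toReal_nonneg

section Tail

variable {Ω : Type*} [MeasurableSpace Ω] {P : Measure Ω} [IsProbabilityMeasure P] {X Y : Ω → ℝ}

lemma tail_le_one (x : ℝ) : tail P X x ≤ 1 := measureReal_le_one

lemma tail_antitone : Antitone (tail P X) := fun _ _ hxy =>
  measureReal_mono fun _ hω => lt_of_le_of_lt hxy hω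

lemma tail_eq_one_sub (hX : Measurable X) (x : ℝ) : tail P X x = 1 - cdf' P X x := by
  have h : {ω | x < X ω} = {ω | X ω ≤ x}ᶜ := by ext ω; simp
  unfold tail cdf'
  rw [h]
  exact probReal_compl_eq_one_sub (measurableSet_le hX measurable_const)

lemma tendsto_tail (hX : Measurable X) : Tendsto (tail P X) atTop (𝓝 0) := by
  have h : Tendsto (P ∘ fun x : ℝ => {ω | x < X ω}) atTop (𝓝 (P (⋂ x : ℝ, {ω | x < X ω}))) :=
    tendsto_measure_iInter_atTop
      (fun x => (measurableSet_lt measurable_const hX).nullMeasurableSet)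
      (fun _ _ hxy _ hω => lt_of_le_of_lt hxy hω) ⟨0, measure_ne_top _ _⟩
  have h0 : (⋂ x : ℝ, {ω | x < X ω}) = ∅ :=
    Set.eq_empty_of_forall_notMem fun ω hω => lt_irrefl (X ω) (Set.mem_iInter.1 hω (X ω))
  rw [h0, measure_empty] at h
  exact (ENNReal.tendsto_toReal ENNReal.zero_ne_top).comp h

lemma VaR_le_VaR_add (hX : Measurable X) (hY : Measurable Y) (hY0 : ∀ ω, 0 ≤ Y ω)
    (hXpos : ∀ x, 0 < tail P X x) {c : ℝ}
    (hc : ∀ᶠ z in atTop, tail P Y (z + c) ≤ tail P X z) :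
    ∀ᶠ α in 𝓝[<] (1 : ℝ), VaR P Y α ≤ VaR P X α + c := by
  obtain ⟨Z, hZ⟩ := eventually_atTop.1 hc
  have h0 : ∀ᶠ α : ℝ in 𝓝[<] 1, 0 < α := nhdsWithin_le_nhds (lt_mem_nhds one_pos)
  have h1 : ∀ᶠ α : ℝ in 𝓝[<] 1, 1 - tail P X Z < α :=
    nhdsWithin_le_nhds (lt_mem_nhds (by linarith [hXpos Z]))
  filter_upwards [h0, h1, self_mem_nhdsWithin] with α hα0 hαZ hα1
  have hα1 : α < 1 := hα1
  rw [← sub_le_iff_le_add]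
  refine le_csInf ?_ fun z hz => ?_
  · obtain ⟨z, hz⟩ := ((tendsto_tail (P := P) hX).eventually
      (gt_mem_nhds (sub_pos.2 hα1))).exists
    exact ⟨z, by have := tail_eq_one_sub (P := P) hX z; simp only [Set.mem_ofPred_eq]; linarith⟩
  · have hz : α ≤ cdf' P X z := hz
    have hzt := tail_eq_one_sub (P := P) hX z
    have hZz : Z ≤ z := by
      by_contra! hlt
      have := tail_antitone (P := P) (X := X) hlt.le
      linarith
    rw [sub_le_iff_le_add]
    refine csInf_le ⟨0, fun y hy => ?_⟩ ?_
    · by_contra! hneg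
      have hy : α ≤ cdf' P Y y := hy
      have hempty : {ω | Y ω ≤ y} = ∅ :=
        Set.eq_empty_of_forall_notMem fun ω hω => absurd (hω.trans_lt hneg) (hY0 ω).not_gt
      rw [cdf', hempty] at hy
      simp at hy
      linarith
    · have h2 := hZ z hZz
      have h3 := tail_eq_one_sub (P := P) hY (z + c)
      simp only [Set.mem_ofPred_eq]
      linarith

lemma integrable_of_regVary_tail (hX : Measurable X) (hX0 : ∀ ω, 0 ≤ X ω) {γ : ℝ} (hγ : 1 < γ)
    (hRV : RegVary (tail P X) (-γ)) : Integrable X P := by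
  obtain ⟨p, hp1, hpγ⟩ := exists_between hγ
  have hpow : RegVary (fun x : ℝ => x ^ (-p)) (-p) := fun t ht => by
    refine tendsto_const_nhds.congr' ?_
    filter_upwards [eventually_gt_atTop 0] with x hx
    rw [Real.mul_rpow ht.le hx.le, mul_div_cancel_right₀ _ (Real.rpow_pos_of_pos hx _).ne']
  have hlim := hRV.tendsto_div_zero (x₀ := 1) hpow (by linarith) tail_nonneg tail_antitone
    (fun x hx => Real.rpow_pos_of_pos (by linarith) _)
    (fun x y hx hxy => Real.rpow_le_rpow_of_nonpos (by linarith) hxy (by linarith))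
  obtain ⟨Z, hZ⟩ := eventually_atTop.1
    ((hlim.eventually (gt_mem_nhds one_pos)).and (eventually_ge_atTop 1))
  have hZ1 : 1 ≤ Z := (hZ Z le_rfl).2
  refine ⟨hX.aestronglyMeasurable, ?_⟩
  rw [hasFiniteIntegral_iff_ofReal (ae_of_all _ hX0),
    lintegral_eq_lintegral_meas_lt P (ae_of_all _ hX0) hX.aemeasurable,
    ← Set.Ioc_union_Ioi_eq_Ioi (show (0 : ℝ) ≤ Z by linarith)]
  refine (lintegral_union_le _ _ _).trans_lt (ENNReal.add_lt_top.2 ⟨?_, ?_⟩)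
  · refine (lintegral_mono fun t => prob_le_one).trans_lt ?_
    simp
  · refine lt_of_le_of_lt ?_
      (integrableOn_Ioi_rpow_of_lt (a := -p) (c := Z) (by linarith) (by linarith)).lintegral_lt_top
    refine setLIntegral_mono' measurableSet_Ioi fun t ht => ?_
    have ht : Z < t := ht
    have h1 := (hZ t ht.le).1
    rw [div_lt_one (Real.rpow_pos_of_pos (by linarith) _)] at h1
    rw [← ENNReal.ofReal_toReal (measure_ne_top P {a | t < X a})]
    exact ENNReal.ofReal_le_ofReal h1.le

lemma tail_add_eq_integral {L S : Ω → ℝ} (hL : Measurable L) (hS : Measurable S)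
    (hindep : IndepFun L S P) (x : ℝ) :
    tail P (fun ω => L ω + S ω) x = ∫ ω, tail P L (x - S ω) ∂P := by
  have hset : MeasurableSet {p : ℝ × ℝ | x < p.1 + p.2} :=
    measurableSet_lt measurable_const (measurable_fst.add measurable_snd)
  have hmeas : Measurable fun y : ℝ => P {ω | y < L ω} :=
    Antitone.measurable fun _ _ hxy => measure_mono fun _ hω => lt_of_le_of_lt hxy hω
  have h1 : P {ω | x < L ω + S ω} = ∫⁻ ω, P {ω' | x - S ω < L ω'} ∂P := by
    have h2 : P {ω | x < L ω + S ω} =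
        (P.map fun ω => (L ω, S ω)) {p : ℝ × ℝ | x < p.1 + p.2} := by
      rw [Measure.map_apply (hL.prodMk hS) hset]; rfl
    rw [h2, (indepFun_iff_map_prod_eq_prod_map_map hL.aemeasurable hS.aemeasurable).1 hindep]
    have := Measure.isProbabilityMeasure_map (μ := P) hL.aemeasurable
    have := Measure.isProbabilityMeasure_map (μ := P) hS.aemeasurable
    rw [Measure.prod_apply_symm hset, lintegral_map (measurable_measure_prodMk_right hset) hS]
    refine lintegral_congr fun ω => ?_
    rw [Measure.map_apply hL (measurable_prodMk_right hset)]
    congr 1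
    ext ω'
    simp [sub_lt_iff_lt_add]
  unfold tail
  rw [h1, integral_toReal]
  · exact (hmeas.comp (measurable_const.sub hS)).aemeasurable
  · exact ae_of_all _ fun ω => measure_lt_top _ _

lemma tendsto_tail_add_sub_div {L S : Ω → ℝ} (hL : Measurable L) (hS : Measurable S)
    (hindep : IndepFun L S P) (hS0 : ∀ ω, 0 ≤ S ω) (hSint : Integrable S P)
    {f : ℝ → ℝ} {x₀ k : ℝ} (hd : DensityBounds (tail P L) f x₀)
    (hf : ∀ x, x₀ ≤ x → 0 < f x) (hmono : ∀ x y, x₀ ≤ x → x ≤ y → f y ≤ f x)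
    (hRV : RegVary f k) (hSf : Tendsto (fun x => tail P S x / f x) atTop (𝓝 0)) :
    Tendsto (fun x => (tail P (fun ω => L ω + S ω) x - tail P L x) / f x) atTop
      (𝓝 (∫ ω, S ω ∂P)) := by
  set g : ℝ → Ω → ℝ := fun x ω => (tail P L (x - S ω) - tail P L x) / f x
  have hhalf : Tendsto (fun x : ℝ => 2⁻¹ * x) atTop atTop :=
    tendsto_id.const_mul_atTop (by norm_num)
  have hlarge : ∀ᶠ x in atTop, x₀ ≤ x ∧ x₀ ≤ 2⁻¹ * x :=
    (eventually_ge_atTop x₀).and (hhalf.eventually_ge_atTop x₀)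
  have hgmeas : ∀ x, Measurable (g x) := fun x =>
    (((tail_antitone (P := P) (X := L)).measurable.comp
      (measurable_const.sub hS)).sub_const _).div_const _
  have hg0 : ∀ x, x₀ ≤ x → ∀ ω, 0 ≤ g x ω := fun x hx ω =>
    div_nonneg (sub_nonneg.2 (tail_antitone (by linarith [hS0 ω]))) (hf x hx).le
  have hg1 : ∀ x, x₀ ≤ x → ∀ ω, g x ω ≤ 1 / f x := fun x hx ω =>
    div_le_div_of_nonneg_right ((sub_le_self _ (tail_nonneg x)).trans (tail_le_one _)) (hf x hx).le
  have hgint : ∀ x, x₀ ≤ x → Integrable (g x) P := fun x hx =>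
    Integrable.of_bound (hgmeas x).aestronglyMeasurable (1 / f x) (ae_of_all _ fun ω => by
      rw [Real.norm_of_nonneg (hg0 x hx ω)]; exact hg1 x hx ω)
  set A : ℝ → Set Ω := fun x => {ω | 2⁻¹ * x < S ω}
  have hA : ∀ x, MeasurableSet (A x) := fun x => measurableSet_lt measurable_const hS
  have hmain : Tendsto (fun x => ∫ ω, (A x)ᶜ.indicator (g x) ω ∂P) atTop (𝓝 (∫ ω, S ω ∂P)) := by
    have hC := (hRV 2⁻¹ (by norm_num)).eventually (gt_mem_nhds (lt_add_one _))
    refine tendsto_integral_filter_of_dominated_convergence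
      (fun ω => ((2⁻¹ : ℝ) ^ k + 1) * S ω)
      (Eventually.of_forall fun x => ((hgmeas x).indicator (hA x).compl).aestronglyMeasurable)
      ?_ (hSint.const_mul _) (ae_of_all _ fun ω => ?_)
    · filter_upwards [hC, hlarge] with x h1 ⟨h2, h3⟩
      refine ae_of_all _ fun ω => ?_
      have hk : (0 : ℝ) ≤ 2⁻¹ ^ k + 1 := by positivity
      by_cases hω : ω ∈ (A x)ᶜ
      · rw [Set.indicator_of_mem hω, Real.norm_of_nonneg (hg0 x h2 ω)]
        have hω : S ω ≤ 2⁻¹ * x := not_lt.1 hω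
        have h4 := (hd (x - S ω) x (by linarith) h2).2
        have h5 := hmono (2⁻¹ * x) (x - S ω) h3 (by linarith)
        rw [div_lt_iff₀ (hf x h2)] at h1
        rw [div_le_iff₀ (hf x h2)]
        rw [sub_sub_cancel] at h4
        calc _ ≤ S ω * f (x - S ω) := h4
          _ ≤ S ω * (((2⁻¹ : ℝ) ^ k + 1) * f x) :=
            mul_le_mul_of_nonneg_left (h5.trans h1.le) (hS0 ω)
          _ = _ := by ring
      · rw [Set.indicator_of_notMem hω, norm_zero]
        exact mul_nonneg hk (hS0 ω)
    · refine (hd.tendsto_sub_div hf (hRV.tendsto_add_div hf hmono) (S ω)).congr' ?_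
      filter_upwards [hhalf.eventually_ge_atTop (S ω)] with x hx
      exact (Set.indicator_of_mem (show ω ∈ (A x)ᶜ from not_lt.2 hx) (g x)).symm
  have hrest : Tendsto (fun x => ∫ ω, (A x).indicator (g x) ω ∂P) atTop (𝓝 0) := by
    have h1 : Tendsto (fun x => tail P S (2⁻¹ * x) / f x) atTop (𝓝 0) := by
      have h2 := (hSf.comp hhalf).mul (hRV 2⁻¹ (by norm_num))
      rw [zero_mul] at h2
      refine h2.congr' ?_
      filter_upwards [hlarge] with x ⟨h3, h4⟩
      exact div_mul_div_cancel₀ (hf _ h4).ne'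
    refine tendsto_of_tendsto_of_tendsto_of_le_of_le' tendsto_const_nhds h1 ?_ ?_
    · filter_upwards [eventually_ge_atTop x₀] with x hx
      exact integral_nonneg fun ω => Set.indicator_nonneg (fun ω _ => hg0 x hx ω) ω
    · filter_upwards [eventually_ge_atTop x₀] with x hx
      calc ∫ ω, (A x).indicator (g x) ω ∂P ≤ ∫ ω, (A x).indicator (fun _ => 1 / f x) ω ∂P :=
            integral_mono ((hgint x hx).indicator (hA x))
              ((integrable_const _).indicator (hA x))
              fun ω => Set.indicator_le_indicator (hg1 x hx ω)
        _ = tail P S (2⁻¹ * x) / f x := by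
            rw [integral_indicator_const _ (hA x), smul_eq_mul, mul_one_div]
            rfl
  have hsum := hrest.add hmain
  rw [zero_add] at hsum
  refine hsum.congr' ?_
  filter_upwards [eventually_ge_atTop x₀] with x hx
  rw [← integral_add ((hgint x hx).indicator (hA x)) ((hgint x hx).indicator (hA x).compl)]
  have hcomb : ∀ ω, (A x).indicator (g x) ω + (A x)ᶜ.indicator (g x) ω = g x ω := fun ω =>
    congrFun (Set.indicator_self_add_compl (A x) (g x)) ω
  simp_rw [hcomb]
  have hint : Integrable (fun ω => tail P L (x - S ω)) P :=
    Integrable.of_bound ((tail_antitone (P := P) (X := L)).measurable.comp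
      (measurable_const.sub hS)).aestronglyMeasurable 1 (ae_of_all _ fun ω => by
        rw [Real.norm_of_nonneg (tail_nonneg _)]; exact tail_le_one _)
  rw [integral_div, integral_sub hint (integrable_const _), tail_add_eq_integral hL hS hindep]
  simp

lemma densityBounds_tail {L : Ω → ℝ} (hL : Measurable L) {f : ℝ → ℝ} {x₀ : ℝ}
    (hmono : ∀ x y, x₀ ≤ x → x ≤ y → f y ≤ f x)
    (hdens : ∀ x, x₀ ≤ x → cdf' P L x = cdf' P L x₀ + ∫ y in x₀..x, f y) :
    DensityBounds (tail P L) f x₀ := by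
  have hint : ∀ x y, x₀ ≤ x → x₀ ≤ y → IntervalIntegrable f volume x y := fun x y hx hy =>
    AntitoneOn.intervalIntegrable fun a ha b _ hab => hmono a b ((le_min hx hy).trans ha.1) hab
  have hle : ∀ x y, x₀ ≤ x → x ≤ y →
      (y - x) * f y ≤ tail P L x - tail P L y ∧ tail P L x - tail P L y ≤ (y - x) * f x := by
    intro x y hx hxy
    have hy := hx.trans hxy
    have heq : tail P L x - tail P L y = ∫ u in x..y, f u := by
      rw [tail_eq_one_sub hL, tail_eq_one_sub hL, hdens x hx, hdens y hy,
        ← intervalIntegral.integral_add_adjacent_intervals (hint x₀ x le_rfl hx) (hint x y hx hy)]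
      ring
    rw [heq]
    constructor
    · have := intervalIntegral.integral_mono_on hxy intervalIntegrable_const (hint x y hx hy)
        fun u hu => hmono u y (hx.trans hu.1) hu.2
      simpa using this
    · have := intervalIntegral.integral_mono_on hxy (hint x y hx hy) intervalIntegrable_const
        fun u hu => hmono x u hx hu.1
      simpa using this
  intro x y hx hy
  rcases le_total x y with h | h
  · exact hle x y hx h
  · obtain ⟨h1, h2⟩ := hle y x hy h
    constructor <;> linarith

end Tail

theorem stmt6 {Ω : Type*} [MeasurableSpace Ω] (P : Measure Ω) [IsProbabilityMeasure P]
    (L S : Ω → ℝ) (hL : Measurable L) (hS : Measurable S)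
    (hindep : IndepFun L S P)
    (hLpos : ∀ ω, 0 ≤ L ω) (hSpos : ∀ ω, 0 ≤ S ω)
    (β γ : ℝ) (hβ : 0 < β) (hβγ : β + 1 < γ)
    (hRVL : RegVary (tail P L) (-β)) (hRVS : RegVary (tail P S) (-γ))
    (x₀ : ℝ) (hx₀ : 0 < x₀) (fL : ℝ → ℝ)
    (hfLpos : ∀ x, x₀ ≤ x → 0 < fL x)
    (hfLmono : ∀ x y, x₀ ≤ x → x ≤ y → fL y ≤ fL x)
    (hfLdens : ∀ x, x₀ ≤ x → cdf' P L x = cdf' P L x₀ + ∫ y in x₀..x, fL y)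
 :
    Tendsto (fun α => VaR P (fun ω => L ω + S ω) α - VaR P L α)
      (𝓝[<] (1 : ℝ)) (𝓝 (∫ ω, S ω ∂P)) := by
  have hd : DensityBounds (tail P L) fL x₀ := densityBounds_tail hL hfLmono hfLdens
  have hFpos : ∀ x, 0 < tail P L x := by
    intro x
    have hm : x₀ ≤ max x x₀ := le_max_right _ _
    have h1 := (hd (max x x₀) (max x x₀ + 1) hm (by linarith)).1
    have h2 := hfLpos (max x x₀ + 1) (by linarith)
    have h3 := tail_nonneg (P := P) (X := L) (max x x₀ + 1)
    have h4 := tail_antitone (P := P) (X := L) (le_max_left x x₀)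
    linarith
  have hRVf := hd.regVary (fun x _ => hFpos x) hfLpos hβ hRVL
  have hSf := hRVS.tendsto_div_zero hRVf (by linarith) tail_nonneg tail_antitone hfLpos hfLmono
  have hSint := integrable_of_regVary_tail hS hSpos (by linarith) hRVS
  have hsum := tendsto_tail_add_sub_div hL hS hindep hSpos hSint hd hfLpos hfLmono hRVf hSf
  have hshift := hd.tendsto_sub_div hfLpos (hRVf.tendsto_add_div hfLpos hfLmono)
  have hLS : Measurable fun ω => L ω + S ω := hL.add hS
  have hLSpos : ∀ x, 0 < tail P (fun ω => L ω + S ω) x := fun x =>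
    (hFpos x).trans_le (measureReal_mono fun ω (hω : x < L ω) => by
      simp only [Set.mem_ofPred_eq]; linarith [hSpos ω])
  set m := ∫ ω, S ω ∂P
  have hupper : ∀ c, m < c →
      ∀ᶠ α in 𝓝[<] (1 : ℝ), VaR P (fun ω => L ω + S ω) α ≤ VaR P L α + c := by
    intro c hc
    refine VaR_le_VaR_add hL hLS (fun ω => add_nonneg (hLpos ω) (hSpos ω)) hFpos ?_
    have h1 : ∀ᶠ x in atTop, tail P (fun ω => L ω + S ω) x ≤ tail P L (x - c) := by
      filter_upwards [hsum.eventually_lt (hshift c) hc, eventually_ge_atTop x₀] with x h2 h3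
      have := (div_lt_div_iff_of_pos_right (hfLpos x h3)).1 h2
      linarith
    filter_upwards [(tendsto_atTop_add_const_right atTop c tendsto_id).eventually h1] with z hz
    simpa using hz
  have hlower : ∀ c, c < m →
      ∀ᶠ α in 𝓝[<] (1 : ℝ), VaR P L α ≤ VaR P (fun ω => L ω + S ω) α + -c := by
    intro c hc
    refine VaR_le_VaR_add hLS hL hLpos hLSpos ?_
    filter_upwards [(hshift c).eventually_lt hsum hc, eventually_ge_atTop x₀] with x h2 h3
    have := (div_lt_div_iff_of_pos_right (hfLpos x h3)).1 h2
    rw [← sub_eq_add_neg]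
    linarith
  rw [tendsto_order]
  constructor
  · intro a ha
    obtain ⟨c, hac, hcm⟩ := exists_between ha
    filter_upwards [hlower c hcm] with α hα
    linarith
  · intro a ha
    obtain ⟨c, hmc, hca⟩ := exists_between ha
    filter_upwards [hupper c hmc] with α hα
    linarith
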